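/- Recursive language characterization (single recursion): let a, b, f be three distinct activities in 𝔸. Then L(▽_f(×(→(a, △_f), b))) consists exactly of the traces ⟨e₁, …, e_{n+1}⟩ for n ≥ 0, where for 1 ≤ i ≤ n the event eᵢ is the sequence consisting of i copies of f followed by a, and the event e_{n+1} is the sequence consisting of n+1 copies of f followed by b. -/

import Mathlib

/-- Symbols: activities `a ∈ 𝔸` and recursion markers `△_f`. -/
inductive HSym (A : Type*) where
  | act : A → HSym A
  | mark : A → HSym A

/-- An event is a finite sequence of symbols. -/
abbrev Event (A : Type*) := List (HSym A)

/-- A hierarchical trace is a finite sequence of events. -/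
abbrev HTrace (A : Type*) := List (Event A)

/-- Hierarchy concatenation `s.t`: prefix the symbol `s` to every event of the trace `t`
(for the empty trace it yields the single event `⟨s⟩`). -/
def hcat {A : Type*} (s : HSym A) : HTrace A → HTrace A
  | [] => [[s]]
  | t => t.map (s :: ·)

/-- Interleaving (shuffle) of two sequences. -/
inductive Interleaving {α : Type*} : List α → List α → List α → Prop
  | nil : Interleaving [] [] []
  | left {a t₁ t₂ t} : Interleaving t₁ t₂ t → Interleaving (a :: t₁) t₂ (a :: t)
  | right {a t₁ t₂ t} : Interleaving t₁ t₂ t → Interleaving t₁ (a :: t₂) (a :: t)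

/-- Sequence join. -/
def seqJoin {α : Type*} : List (Set (List α)) → Set (List α)
  | [] => {[]}
  | L :: Ls => {t | ∃ t₁ ∈ L, ∃ t₂ ∈ seqJoin Ls, t = t₁ ++ t₂}

/-- Exclusive-choice join. -/
def choiceJoin {α : Type*} (Ls : List (Set (List α))) : Set (List α) :=
  {t | ∃ L ∈ Ls, t ∈ L}

/-- Members of the loop language. -/
inductive LoopMem {α : Type*} (body redo : Set (List α)) : List α → Prop
  | single {t} : t ∈ body → LoopMem body redo t
  | cons {t t' r} : t ∈ body → t' ∈ redo → LoopMem body redo r →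
      LoopMem body redo (t ++ t' ++ r)

/-- Structured-loop join. -/
def loopJoin {α : Type*} : List (Set (List α)) → Set (List α)
  | [] => ∅
  | L :: Ls => {t | LoopMem L (choiceJoin Ls) t}

/-- Parallel join. -/
def parJoin {α : Type*} : List (Set (List α)) → Set (List α)
  | [] => {[]}
  | L :: Ls => {t | ∃ t₁ ∈ L, ∃ t₂ ∈ parJoin Ls, Interleaving t₁ t₂ t}

/-- Hierarchical process trees: process trees extended with the named-subtree
operator `▽_f` and the recursion leaf `△_f`. -/
inductive HTree (A : Type*) where
  | act : A → HTree A
  | tau : HTree A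
  | seq : List (HTree A) → HTree A
  | choice : List (HTree A) → HTree A
  | loop : List (HTree A) → HTree A
  | par : List (HTree A) → HTree A
  | named : A → HTree A → HTree A
  | recCall : A → HTree A

universe u

mutual
/-- `▽ˡ_f(M)`: the least hierarchical language satisfying
`▽ˡ_f(M) = { f.(t′₁ ⋯ t′ₙ) | ⟨x₁,…,xₙ⟩ ∈ M, t′ᵢ ∈ ψ_f(xᵢ) }`. -/
inductive NamedLang {A : Type u} (f : A) (M : Set (HTrace A)) : HTrace A → Prop
  | mk (xs : HTrace A) (ts : List (HTrace A)) :
      xs ∈ M → ts.length = xs.length →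
      (∀ i, Psi f M (xs.getD i []) (ts.getD i [])) →
      NamedLang f M (hcat (HSym.act f) ts.flatten)

/-- `ψ_f`: maps an event to the set of traces resolving the recursion markers `△_f`. -/
inductive Psi {A : Type u} (f : A) (M : Set (HTrace A)) : Event A → HTrace A → Prop
  | nil : Psi f M [] []
  | recSame {t : HTrace A} : NamedLang f M t → Psi f M [HSym.mark f] t
  | recOther {g : A} : g ≠ f → Psi f M [HSym.mark g] [[HSym.mark g]]
  | act {a : A} {x : Event A} {t : HTrace A} :
      Psi f M x t → Psi f M (HSym.act a :: x) (hcat (HSym.act a) t)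
end

/-- The hierarchical language of a hierarchical process tree. -/
def hlang {A : Type*} : HTree A → Set (HTrace A)
  | .act a => {[[HSym.act a]]}
  | .tau => {[]}
  | .recCall f => {[[HSym.mark f]]}
  | .seq Ps => seqJoin (Ps.attach.map fun p => hlang p.1)
  | .choice Ps => choiceJoin (Ps.attach.map fun p => hlang p.1)
  | .loop Ps => loopJoin (Ps.attach.map fun p => hlang p.1)
  | .par Ps => parJoin (Ps.attach.map fun p => hlang p.1)
  | .named f P => {t | NamedLang f (hlang P) t}
termination_by P => sizeOf P
decreasing_by
  all_goals first
    | (have := List.sizeOf_lt_of_mem p.2; simp; omega)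
    | simp

/-- Plain process trees: no named subtrees `▽` and no recursion leaves `△`. -/
inductive IsPlain {A : Type*} : HTree A → Prop
  | act (a : A) : IsPlain (HTree.act a)
  | tau : IsPlain HTree.tau
  | seq {Ps : List (HTree A)} : (∀ P ∈ Ps, IsPlain P) → IsPlain (HTree.seq Ps)
  | choice {Ps : List (HTree A)} : (∀ P ∈ Ps, IsPlain P) → IsPlain (HTree.choice Ps)
  | loop {Ps : List (HTree A)} : (∀ P ∈ Ps, IsPlain P) → IsPlain (HTree.loop Ps)
  | par {Ps : List (HTree A)} : (∀ P ∈ Ps, IsPlain P) → IsPlain (HTree.par Ps)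


/-- The trace `⟨f·a, f²·a, …, fⁿ·a, f^{n+1}·b⟩`. -/
def nestedTrace {A : Type*} (a b f : A) (n : ℕ) : HTrace A :=
  (List.range n).map (fun i => List.replicate (i + 1) (HSym.act f) ++ [HSym.act a])
    ++ [List.replicate (n + 1) (HSym.act f) ++ [HSym.act b]]

theorem hcat_cons {A : Type*} (s : HSym A) (x : Event A) (t : HTrace A) :
    hcat s (x :: t) = (x :: t).map (s :: ·) := rfl

theorem nestedTrace_zero {A : Type*} (a b f : A) :
    nestedTrace a b f 0 = hcat (HSym.act f) [[HSym.act b]] := rfl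

theorem nestedTrace_succ {A : Type*} (a b f : A) (n : ℕ) :
    nestedTrace a b f (n + 1) = hcat (HSym.act f) ([HSym.act a] :: nestedTrace a b f n) := by
  simp [nestedTrace, hcat_cons, List.range_succ_eq_map, List.replicate_succ]

theorem psi_act_singleton_iff {A : Type*} {f c : A} {M : Set (HTrace A)} {t : HTrace A} :
    Psi f M [HSym.act c] t ↔ t = [[HSym.act c]] := by
  constructor
  · intro h
    cases h with
    | act h => cases h; rfl
  · rintro rfl
    exact Psi.act Psi.nil

theorem hlang_act_seq_recCall_choice {A : Type*} (a b f : A) :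
    hlang (HTree.choice [HTree.seq [HTree.act a, HTree.recCall f], HTree.act b]) =
      {[[HSym.act a], [HSym.mark f]], [[HSym.act b]]} := by
  ext t
  simp [hlang, choiceJoin, seqJoin]

theorem exists_nestedTrace_of_namedLang {A : Type*} {a b f : A} {t : HTrace A}
    (h : NamedLang f {[[HSym.act a], [HSym.mark f]], [[HSym.act b]]} t) :
    ∃ n, t = nestedTrace a b f n := by
  refine NamedLang.rec (motive_1 := fun t _ => ∃ n, t = nestedTrace a b f n)
    (motive_2 := fun x t _ => x = [HSym.mark f] → ∃ n, t = nestedTrace a b f n)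
    ?_ ?_ ?_ ?_ ?_ h
  · rintro xs ts (rfl | rfl) hlen hpsi ih
    · match ts, hlen with
      | [t₁, t₂], _ =>
        obtain ⟨n, hn⟩ := ih 1 rfl
        have h₁ := psi_act_singleton_iff.1 (hpsi 0)
        simp only [List.getD_cons_zero, List.getD_cons_succ] at h₁ hn
        exact ⟨n + 1, by simp [h₁, hn, nestedTrace_succ]⟩
    · match ts, hlen with
      | [t₁], _ =>
        have h₁ := psi_act_singleton_iff.1 (hpsi 0)
        simp only [List.getD_cons_zero] at h₁
        exact ⟨0, by simp [h₁, nestedTrace_zero]⟩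
  · simp
  · intro t _ ih _
    exact ih
  · intro g hg h
    simp_all
  · simp

theorem namedLang_nestedTrace {A : Type*} (a b f : A) (n : ℕ) :
    NamedLang f {[[HSym.act a], [HSym.mark f]], [[HSym.act b]]} (nestedTrace a b f n) := by
  induction n with
  | zero =>
    refine NamedLang.mk [[HSym.act b]] [[[HSym.act b]]] (Or.inr rfl) rfl fun i => ?_
    match i with
    | 0 => exact psi_act_singleton_iff.2 rfl
    | _ + 1 => exact Psi.nil
  | succ n ih =>
    have h := NamedLang.mk (f := f) (M := {[[HSym.act a], [HSym.mark f]], [[HSym.act b]]})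
      [[HSym.act a], [HSym.mark f]] [[[HSym.act a]], nestedTrace a b f n] (Or.inl rfl) rfl
      fun i => match i with
        | 0 => psi_act_singleton_iff.2 rfl
        | 1 => Psi.recSame ih
        | _ + 2 => Psi.nil
    simpa [nestedTrace_succ] using h

/-- recursive language characterization (single recursion):
`L(▽_f(×(→(a, △_f), b)))` consists exactly of the traces
`⟨e₁, …, e_{n+1}⟩` where `eᵢ = fⁱ·a` for `1 ≤ i ≤ n` and `e_{n+1} = f^{n+1}·b`. -/
theorem single_recursion_lang {A : Type*} (a b f : A)
    (hab : a ≠ b) (haf : a ≠ f) (hbf : b ≠ f) :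
    hlang (HTree.named f
        (HTree.choice [HTree.seq [HTree.act a, HTree.recCall f], HTree.act b])) =
      {t | ∃ n : ℕ,
        t = (List.range n).map
              (fun i => List.replicate (i + 1) (HSym.act f) ++ [HSym.act a])
            ++ [List.replicate (n + 1) (HSym.act f) ++ [HSym.act b]]} := by
  rw [hlang, hlang_act_seq_recCall_choice]
  ext t
  constructor
  · exact exists_nestedTrace_of_namedLang
  · rintro ⟨n, rfl⟩
    exact namedLang_nestedTrace a b f n
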